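/- Suppose the semidefinite system (P_SD) is in good normal form. Then (P_SD) is well behaved: for every c ∈ ℝ^m such that v = sup{Σ c_i x_i : x feasible in (P_SD)} is finite, there exists a symmetric positive semidefinite matrix Y with A_i•Y = c_i for all i and B•Y = v. -/

import Mathlib

open Matrix

/-- Trace inner product `S • T = trace(ST)` of square real matrices. -/
noncomputable def ip {k : ℕ} (S T : Matrix (Fin k) (Fin k) ℝ) : ℝ :=
  Matrix.trace (S * T)

/-- `x` is feasible for the semidefinite system `∑ xᵢ Aᵢ ⪯ B`. -/
def IsFeasible {n m : ℕ} (A : Fin m → Matrix (Fin n) (Fin n) ℝ)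
    (B : Matrix (Fin n) (Fin n) ℝ) (x : Fin m → ℝ) : Prop :=
  (B - ∑ i, x i • A i).PosSemidef

/-- The set of primal objective values `∑ cᵢ xᵢ` over feasible `x`. -/
def PrimalVals {n m : ℕ} (A : Fin m → Matrix (Fin n) (Fin n) ℝ)
    (B : Matrix (Fin n) (Fin n) ℝ) (c : Fin m → ℝ) : Set ℝ :=
  {s | ∃ x : Fin m → ℝ, IsFeasible A B x ∧ s = ∑ i, c i * x i}

/-- The system `∑ xᵢ Aᵢ ⪯ B` is badly behaved: for some `c` the primal optimal
value is finite (i.e. is a least upper bound `v`), but no dual feasible `Y`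
achieves value `v`. -/
def BadlyBehaved {n m : ℕ} (A : Fin m → Matrix (Fin n) (Fin n) ℝ)
    (B : Matrix (Fin n) (Fin n) ℝ) : Prop :=
  ∃ (c : Fin m → ℝ) (v : ℝ), IsLUB (PrimalVals A B c) v ∧
    ¬ ∃ Y : Matrix (Fin n) (Fin n) ℝ,
        Y.PosSemidef ∧ (∀ i, ip (A i) Y = c i) ∧ ip B Y = v

/-- `Zmat n r = diag(I_r, 0)`. -/
def Zmat (n r : ℕ) : Matrix (Fin n) (Fin n) ℝ :=
  Matrix.of fun i j => if i = j ∧ (i : ℕ) < r then (1 : ℝ) else 0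

/-- `Zmat n r` is a maximum rank slack of `∑ xᵢ Aᵢ ⪯ B`:
it is a slack and every slack has rank at most `r`. -/
def MaxRankSlack {n m : ℕ} (A : Fin m → Matrix (Fin n) (Fin n) ℝ)
    (B : Matrix (Fin n) (Fin n) ℝ) (r : ℕ) : Prop :=
  (∃ x : Fin m → ℝ, B - ∑ i, x i • A i = Zmat n r) ∧
  ∀ x : Fin m → ℝ, IsFeasible A B x → (B - ∑ i, x i • A i).rank ≤ r

/-- Lower-right `(n-r) × (n-r)` block. -/
def block22 {n : ℕ} (r : ℕ) (h : r ≤ n) (V : Matrix (Fin n) (Fin n) ℝ) :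
    Matrix (Fin (n - r)) (Fin (n - r)) ℝ :=
  Matrix.of fun i j => V ⟨r + i.1, by omega⟩ ⟨r + j.1, by omega⟩

/-- Upper-right `r × (n-r)` block. -/
def block12 {n : ℕ} (r : ℕ) (h : r ≤ n) (V : Matrix (Fin n) (Fin n) ℝ) :
    Matrix (Fin r) (Fin (n - r)) ℝ :=
  Matrix.of fun i j => V ⟨i.1, by omega⟩ ⟨r + j.1, by omega⟩

/-- The column space (range space) of a matrix. -/
def colSpace {p q : ℕ} (M : Matrix (Fin p) (Fin q) ℝ) : Submodule ℝ (Fin p → ℝ) :=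
  LinearMap.range M.mulVecLin

/-- The "Bad condition": some linear combination `V` of the `Aᵢ` has `V₂₂ ⪰ 0`
and `ℛ(V₁₂ᵀ) ⊄ ℛ(V₂₂)`. -/
def BadCond {n m : ℕ} (A : Fin m → Matrix (Fin n) (Fin n) ℝ) (r : ℕ) (h : r ≤ n) : Prop :=
  ∃ lam : Fin m → ℝ,
    (block22 r h (∑ i, lam i • A i)).PosSemidef ∧
    ¬ colSpace (block12 r h (∑ i, lam i • A i))ᵀ ≤
        colSpace (block22 r h (∑ i, lam i • A i))

/-- `padLow r h U = diag(0, U)` as an `n × n` matrix. -/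
def padLow {n : ℕ} (r : ℕ) (h : r ≤ n) (U : Matrix (Fin (n - r)) (Fin (n - r)) ℝ) :
    Matrix (Fin n) (Fin n) ℝ :=
  Matrix.of fun a b =>
    if hab : r ≤ (a : ℕ) ∧ r ≤ (b : ℕ) then U ⟨a.1 - r, by omega⟩ ⟨b.1 - r, by omega⟩
    else 0

/-- "Good condition 1": some positive definite `U` has `Aᵢ • diag(0, U) = 0` for all `i`. -/
def GoodCond1 {n m : ℕ} (A : Fin m → Matrix (Fin n) (Fin n) ℝ) (r : ℕ) (h : r ≤ n) : Prop :=
  ∃ U : Matrix (Fin (n - r)) (Fin (n - r)) ℝ, U.PosDef ∧ ∀ i, ip (A i) (padLow r h U) = 0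

/-- "Good condition 2": every linear combination of the `Aᵢ` with zero lower-right
block has zero upper-right block. -/
def GoodCond2 {n m : ℕ} (A : Fin m → Matrix (Fin n) (Fin n) ℝ) (r : ℕ) (h : r ≤ n) : Prop :=
  ∀ lam : Fin m → ℝ, block22 r h (∑ i, lam i • A i) = 0 →
    block12 r h (∑ i, lam i • A i) = 0

/-- `Tmat r h N = [[I_r, 0], [0, N]]`. -/
def Tmat {n : ℕ} (r : ℕ) (h : r ≤ n) (N : Matrix (Fin (n - r)) (Fin (n - r)) ℝ) :
    Matrix (Fin n) (Fin n) ℝ :=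
  Matrix.of fun a b =>
    if (a : ℕ) < r ∧ (b : ℕ) < r then (if a = b then (1 : ℝ) else 0)
    else if hab : r ≤ (a : ℕ) ∧ r ≤ (b : ℕ) then N ⟨a.1 - r, by omega⟩ ⟨b.1 - r, by omega⟩
    else 0

/-- The system `∑ xᵢ A'ᵢ ⪯ B'` is an elementary reformulation of `∑ xᵢ Aᵢ ⪯ B`:
there are an invertible `M : ℝ^{m×m}`, a vector `μ ∈ ℝ^m` and an invertible
`T = [[I_r, 0], [0, N]]` with `A'ᵢ = Tᵀ (∑ⱼ Mᵢⱼ Aⱼ) T` and `B' = Tᵀ (B + ∑ⱼ μⱼ Aⱼ) T`. -/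
def ElemReform {n m : ℕ} (r : ℕ) (h : r ≤ n)
    (A : Fin m → Matrix (Fin n) (Fin n) ℝ) (B : Matrix (Fin n) (Fin n) ℝ)
    (A' : Fin m → Matrix (Fin n) (Fin n) ℝ) (B' : Matrix (Fin n) (Fin n) ℝ) : Prop :=
  ∃ (M : Matrix (Fin m) (Fin m) ℝ) (μ : Fin m → ℝ)
    (N : Matrix (Fin (n - r)) (Fin (n - r)) ℝ),
    IsUnit M ∧ IsUnit (Tmat r h N) ∧
    (∀ i, A' i = (Tmat r h N)ᵀ * (∑ j, M i j • A j) * Tmat r h N) ∧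
    B' = (Tmat r h N)ᵀ * (B + ∑ j, μ j • A j) * Tmat r h N

/-- The last `n - r` columns of a square matrix, as an `n × (n-r)` matrix. -/
def lastCols {n : ℕ} (r : ℕ) (h : r ≤ n) (V : Matrix (Fin n) (Fin n) ℝ) :
    Matrix (Fin n) (Fin (n - r)) ℝ :=
  Matrix.of fun a j => V a ⟨r + j.1, by omega⟩

/-- Bad normal form of a semidefinite system. -/
def BadNormalForm {n m : ℕ} (A : Fin m → Matrix (Fin n) (Fin n) ℝ)
    (B : Matrix (Fin n) (Fin n) ℝ) (r : ℕ) (h : r ≤ n) : Prop :=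
  B = Zmat n r ∧ MaxRankSlack A B r ∧
  ∃ k : ℕ, ∃ hk : k < m,
    (∀ i : Fin m, (i : ℕ) < k → ∀ a b : Fin n, r ≤ (b : ℕ) → A i a b = 0) ∧
    (∀ i : Fin m, (i : ℕ) < k → ∀ a b : Fin n, r ≤ (a : ℕ) → A i a b = 0) ∧
    LinearIndependent ℝ (fun i : Fin (m - k) => lastCols r h (A ⟨k + i.1, by omega⟩)) ∧
    (block22 r h (A ⟨m - 1, by omega⟩)).PosSemidef

/-- Good normal form of a semidefinite system. -/
def GoodNormalForm {n m : ℕ} (A : Fin m → Matrix (Fin n) (Fin n) ℝ)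
    (B : Matrix (Fin n) (Fin n) ℝ) (r : ℕ) (h : r ≤ n) : Prop :=
  B = Zmat n r ∧ MaxRankSlack A B r ∧
  ∃ k : ℕ, ∃ _hk : k ≤ m,
    (∀ i : Fin m, (i : ℕ) < k → ∀ a b : Fin n,
        (r ≤ (a : ℕ) ∨ r ≤ (b : ℕ)) → A i a b = 0) ∧
    LinearIndependent ℝ (fun i : Fin (m - k) => block22 r h (A ⟨k + i.1, by omega⟩)) ∧
    ∃ U : Matrix (Fin (n - r)) (Fin (n - r)) ℝ, U.PosDef ∧
      ∀ i : Fin m, k ≤ (i : ℕ) → ip (block22 r h (A i)) U = 0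

/-- The image of the positive semidefinite cone under `Y ↦ (A₁ • Y, …, A_m • Y)`. -/
def imageSet {n m : ℕ} (A : Fin m → Matrix (Fin n) (Fin n) ℝ) : Set (Fin m → ℝ) :=
  {y | ∃ Y : Matrix (Fin n) (Fin n) ℝ, Y.PosSemidef ∧ ∀ i, ip (A i) Y = y i}

theorem LinearIndependent.exists_linearMap_apply_eq {K V ι : Type*} [Field K] [AddCommGroup V]
    [Module K V] {w : ι → V} (hw : LinearIndependent K w) (d : ι → K) :
    ∃ f : V →ₗ[K] K, ∀ i, f (w i) = d i := by
  obtain ⟨g, hg⟩ := LinearMap.exists_extend ((Module.Basis.span hw).constr K d)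
  refine ⟨g, fun i => ?_⟩
  have h := LinearMap.congr_fun hg (Module.Basis.span hw i)
  rwa [Module.Basis.constr_basis, LinearMap.comp_apply, Submodule.subtype_apply,
    Module.Basis.span_apply] at h

/-- M. Riesz extension for a functional given through a linear parametrization `L` of the
subspace on which it is prescribed. -/
theorem riesz_extension_of_parametrization {P E : Type*} [AddCommGroup P] [Module ℝ P]
    [AddCommGroup E] [Module ℝ E] (s : PointedCone ℝ E) (L : P →ₗ[ℝ] E) (f : P →ₗ[ℝ] ℝ)
    (nonneg : ∀ p, L p ∈ s → 0 ≤ f p) (dense : ∀ y, ∃ p, L p + y ∈ s) :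
    ∃ g : E →ₗ[ℝ] ℝ, (∀ p, g (L p) = f p) ∧ ∀ y ∈ s, 0 ≤ g y := by
  have hker : f ∈ L.ker.dualAnnihilator := by
    rw [Submodule.mem_dualAnnihilator]
    intro p hp
    rw [LinearMap.mem_ker] at hp
    have h₁ := nonneg p (by rw [hp]; exact s.zero_mem)
    have h₂ := nonneg (-p) (by rw [map_neg, hp, neg_zero]; exact s.zero_mem)
    rw [map_neg] at h₂
    linarith
  rw [← LinearMap.range_dualMap_eq_dualAnnihilator_ker] at hker
  obtain ⟨h, hh⟩ := hker
  have hL : ∀ p, h (L p) = f p := fun p => LinearMap.congr_fun hh p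
  obtain ⟨g, hg, hgs⟩ := riesz_extension s ⟨L.range, h.domRestrict L.range⟩
    (by
      rintro ⟨_, p, rfl⟩ hp
      exact (nonneg p hp).trans_eq (hL p).symm)
    (by
      intro y
      obtain ⟨p, hp⟩ := dense y
      exact ⟨⟨L p, p, rfl⟩, hp⟩)
  exact ⟨g, fun p => (hg ⟨L p, p, rfl⟩).trans (hL p), hgs⟩

theorem Matrix.PosDef.exists_nonneg_add_mul {p : ℕ} {U : Matrix (Fin p) (Fin p) ℝ}
    (hU : U.PosDef) (q : (Fin p → ℝ) → ℝ) (hq : Continuous q)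
    (hq2 : ∀ (a : ℝ) y, q (a • y) = a ^ 2 * q y) :
    ∃ t : ℝ, ∀ y, 0 ≤ q y + t * (y ⬝ᵥ U *ᵥ y) := by
  have hu : Continuous fun y : Fin p → ℝ => y ⬝ᵥ U *ᵥ y := by fun_prop
  have hpos : ∀ y : Fin p → ℝ, y ≠ 0 → 0 < y ⬝ᵥ U *ᵥ y := fun y hy => by
    simpa using hU.dotProduct_mulVec_pos hy
  have hne : ∀ y ∈ Metric.sphere (0 : Fin p → ℝ) 1, y ≠ 0 := fun y hy h => by
    simp [h] at hy
  have hsphere : ∃ t : ℝ, ∀ y ∈ Metric.sphere (0 : Fin p → ℝ) 1,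
      0 ≤ q y + t * (y ⬝ᵥ U *ᵥ y) := by
    obtain ⟨b, hb⟩ := (isCompact_sphere (0 : Fin p → ℝ) 1).bddBelow_image
      (hq.continuousOn.div hu.continuousOn fun y hy => (hpos y (hne y hy)).ne')
    refine ⟨-b, fun y hy => ?_⟩
    have h := hb (Set.mem_image_of_mem _ hy)
    rw [Pi.div_apply, le_div_iff₀ (hpos y (hne y hy))] at h
    linarith
  obtain ⟨t, ht⟩ := hsphere
  refine ⟨t, fun y => ?_⟩
  rcases eq_or_ne y 0 with rfl | hy
  · have h := hq2 0 0
    rw [smul_zero, zero_pow two_ne_zero, zero_mul] at h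
    rw [h, zero_dotProduct, mul_zero, add_zero]
  · have hn : ‖y‖ ≠ 0 := norm_ne_zero_iff.mpr hy
    have h := ht (‖y‖⁻¹ • y) (by simp [norm_smul, hn])
    rw [hq2, Matrix.mulVec_smul, dotProduct_smul, smul_dotProduct, smul_eq_mul, smul_eq_mul] at h
    have h' := mul_nonneg (sq_nonneg ‖y‖) h
    refine h'.trans_eq ?_
    have e : ‖y‖ * ‖y‖⁻¹ = 1 := mul_inv_cancel₀ hn
    linear_combination
      (‖y‖ * ‖y‖⁻¹ + 1) * (q y + t * (y ⬝ᵥ U *ᵥ y)) * e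

theorem exists_isSymm_ip_eq {p : ℕ} (φ : Matrix (Fin p) (Fin p) ℝ →ₗ[ℝ] ℝ) :
    ∃ Y : Matrix (Fin p) (Fin p) ℝ, Y.IsSymm ∧ ∀ M, M.IsSymm → ip M Y = φ M := by
  have hφ : ∀ M : Matrix (Fin p) (Fin p) ℝ,
      φ M = ∑ i, ∑ j, M i j * φ (Matrix.single i j 1) := by
    intro M
    conv_lhs => rw [Matrix.matrix_eq_sum_single M]
    simp only [map_sum]
    refine Finset.sum_congr rfl fun i _ => Finset.sum_congr rfl fun j _ => ?_
    rw [← smul_eq_mul, ← map_smul, Matrix.smul_single, smul_eq_mul, mul_one]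
  refine ⟨Matrix.of fun i j => (φ (Matrix.single i j 1) + φ (Matrix.single j i 1)) / 2, ?_, ?_⟩
  · ext i j
    simp [add_comm]
  · intro M hM
    have h : ∑ i, ∑ j, M i j * φ (Matrix.single j i 1) = φ M := by
      rw [Finset.sum_comm, hφ M]
      simp only [hM.apply]
    have h' : ip M (Matrix.of fun i j =>
        (φ (Matrix.single i j 1) + φ (Matrix.single j i 1)) / 2) =
        (∑ i, ∑ j, M i j * φ (Matrix.single j i 1) +
          ∑ i, ∑ j, M i j * φ (Matrix.single i j 1)) / 2 := by
      simp only [ip, Matrix.trace, Matrix.diag, Matrix.mul_apply, Matrix.of_apply,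
        ← Finset.sum_add_distrib, Finset.sum_div]
      refine Finset.sum_congr rfl fun i _ => Finset.sum_congr rfl fun j _ => ?_
      ring
    rw [h', h, ← hφ]
    ring

theorem ip_vecMulVec_self {p : ℕ} (y : Fin p → ℝ) (Y : Matrix (Fin p) (Fin p) ℝ) :
    ip (vecMulVec y y) Y = y ⬝ᵥ Y *ᵥ y := by
  rw [ip, Matrix.vecMulVec_mul, Matrix.trace_vecMulVec, dotProduct_comm, ← dotProduct_mulVec]

/-- A functional that is nonnegative on rank-one matrices `y yᵀ` is represented on symmetric
matrices by a positive semidefinite matrix. -/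
theorem exists_posSemidef_ip_eq {p : ℕ} (φ : Matrix (Fin p) (Fin p) ℝ →ₗ[ℝ] ℝ)
    (hφ : ∀ y, 0 ≤ φ (vecMulVec y y)) :
    ∃ Y : Matrix (Fin p) (Fin p) ℝ, Y.PosSemidef ∧ ∀ M, M.IsSymm → ip M Y = φ M := by
  obtain ⟨Y, hY, h⟩ := exists_isSymm_ip_eq φ
  refine ⟨Y, Matrix.PosSemidef.of_dotProduct_mulVec_nonneg ?_ fun y => ?_, h⟩
  · rwa [Matrix.IsHermitian, Matrix.conjTranspose_eq_transpose_of_trivial]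
  · rw [star_trivial, ← ip_vecMulVec_self, h _ (by
      rw [Matrix.IsSymm, Matrix.transpose_vecMulVec])]
    exact hφ y

/-- Matrices whose quadratic form is nonnegative on vectors supported on the first `r`
coordinates. -/
def leadingCone (n r : ℕ) : PointedCone ℝ (Matrix (Fin n) (Fin n) ℝ) where
  carrier := {M | ∀ y : Fin n → ℝ, (∀ a : Fin n, r ≤ (a : ℕ) → y a = 0) → 0 ≤ y ⬝ᵥ M *ᵥ y}
  add_mem' hM hN y hy := by
    rw [Matrix.add_mulVec, dotProduct_add]
    exact add_nonneg (hM y hy) (hN y hy)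
  zero_mem' y _ := by simp
  smul_mem' a M hM y hy := by
    rw [show a • M = (a : ℝ) • M from rfl, Matrix.smul_mulVec, dotProduct_smul]
    exact mul_nonneg a.2 (hM y hy)

theorem Zmat_mulVec {n r : ℕ} (y : Fin n → ℝ) (a : Fin n) :
    (Zmat n r *ᵥ y) a = if (a : ℕ) < r then y a else 0 := by
  simp [Zmat, mulVec, dotProduct, ite_and]

theorem Zmat_apply_eq_zero {n r : ℕ} {a b : Fin n} (hab : r ≤ (a : ℕ) ∨ r ≤ (b : ℕ)) :
    Zmat n r a b = 0 := by
  simp only [Zmat, Matrix.of_apply, ite_eq_right_iff]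
  rintro ⟨rfl, h⟩
  omega

theorem isSymm_Zmat (n r : ℕ) : (Zmat n r).IsSymm := by
  ext i j
  by_cases h : i = j
  · simp [h]
  · simp [Zmat, h, Ne.symm h]

theorem posSemidef_Zmat (n r : ℕ) : (Zmat n r).PosSemidef := by
  refine Matrix.PosSemidef.of_dotProduct_mulVec_nonneg ?_ fun y => ?_
  · rw [Matrix.IsHermitian, Matrix.conjTranspose_eq_transpose_of_trivial, isSymm_Zmat]
  · refine Finset.sum_nonneg fun a _ => ?_
    rw [Zmat_mulVec]
    split_ifs
    · exact mul_self_nonneg (y a)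
    · simp

theorem exists_smul_Zmat_add_mem_leadingCone {n r : ℕ} (M : Matrix (Fin n) (Fin n) ℝ) :
    ∃ t : ℝ, t • Zmat n r + M ∈ leadingCone n r := by
  obtain ⟨t, ht⟩ := (Matrix.PosDef.one (n := Fin n) (R := ℝ)).exists_nonneg_add_mul
    (fun y => y ⬝ᵥ M *ᵥ y) (by fun_prop) (by
      intro a y
      simp only [Matrix.mulVec_smul, dotProduct_smul, smul_dotProduct, smul_eq_mul]
      ring)
  refine ⟨t, fun y hy => ?_⟩
  have hZ : Zmat n r *ᵥ y = y := by
    funext a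
    rw [Zmat_mulVec]
    split_ifs with h
    · rfl
    · exact (hy a (not_lt.mp h)).symm
  have := ht y
  rw [Matrix.one_mulVec] at this
  rw [Matrix.add_mulVec, Matrix.smul_mulVec, hZ, dotProduct_add, dotProduct_smul, smul_eq_mul,
    add_comm]
  exact this

/-- A symmetric matrix in the leading cone that vanishes outside the leading block is positive
semidefinite. -/
theorem posSemidef_of_mem_leadingCone {n r : ℕ} {M : Matrix (Fin n) (Fin n) ℝ}
    (hs : M.IsSymm) (h0 : ∀ a b : Fin n, (r ≤ (a : ℕ) ∨ r ≤ (b : ℕ)) → M a b = 0)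
    (hM : M ∈ leadingCone n r) : M.PosSemidef := by
  refine Matrix.PosSemidef.of_dotProduct_mulVec_nonneg ?_ fun y => ?_
  · rwa [Matrix.IsHermitian, Matrix.conjTranspose_eq_transpose_of_trivial]
  · have h := hM (fun a => if (a : ℕ) < r then y a else 0) fun a ha => if_neg (not_lt.mpr ha)
    refine h.trans_eq ?_
    rw [star_trivial]
    simp only [dotProduct, mulVec, Finset.mul_sum]
    refine Finset.sum_congr rfl fun a _ => Finset.sum_congr rfl fun b _ => ?_
    by_cases ha : (a : ℕ) < r <;> by_cases hb : (b : ℕ) < r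
    · simp [ha, hb]
    all_goals simp [h0 a b (by omega)]

/-- Dual attainment for the part of the system supported in the leading block, phrased through a
functional on all matrices. -/
theorem exists_nonneg_functional_of_isLUB {n m r : ℕ} {A : Fin m → Matrix (Fin n) (Fin n) ℝ}
    (hA : ∀ i, (A i).IsSymm) {k : ℕ}
    (hk : ∀ i : Fin m, (i : ℕ) < k → ∀ a b : Fin n,
        (r ≤ (a : ℕ) ∨ r ≤ (b : ℕ)) → A i a b = 0)
    {c : Fin m → ℝ} {v : ℝ} (hv : IsLUB (PrimalVals A (Zmat n r) c) v) :
    ∃ g : Matrix (Fin n) (Fin n) ℝ →ₗ[ℝ] ℝ, (∀ i : Fin m, (i : ℕ) < k → g (A i) = c i) ∧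
      g (Zmat n r) = v ∧ ∀ M ∈ leadingCone n r, 0 ≤ g M := by
  have hub : ∀ x, IsFeasible A (Zmat n r) x → ∑ i, c i * x i ≤ v := fun x hx =>
    hv.1 ⟨x, hx, rfl⟩
  let T : (Fin m → ℝ) →ₗ[ℝ] (Fin m → ℝ) :=
    LinearMap.pi fun i => if (i : ℕ) < k then LinearMap.proj i else 0
  have hT : ∀ x i, T x i = if (i : ℕ) < k then x i else 0 := fun x i => by
    simp only [T, LinearMap.pi_apply]
    split_ifs <;> rfl
  let L : ℝ × (Fin m → ℝ) →ₗ[ℝ] Matrix (Fin n) (Fin n) ℝ :=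
    (LinearMap.toSpanSingleton ℝ _ (Zmat n r)).coprod (-(Fintype.linearCombination ℝ A ∘ₗ T))
  have hL : ∀ p, L p = p.1 • Zmat n r - ∑ i, T p.2 i • A i := fun p => by
    simp [L, Fintype.linearCombination_apply, sub_eq_add_neg]
  let f : ℝ × (Fin m → ℝ) →ₗ[ℝ] ℝ :=
    (LinearMap.toSpanSingleton ℝ _ v).coprod (-(Fintype.linearCombination ℝ c ∘ₗ T))
  have hf : ∀ p, f p = p.1 * v - ∑ i, c i * T p.2 i := fun p => by
    simp [f, Fintype.linearCombination_apply, sub_eq_add_neg, mul_comm]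
  have hpsd : ∀ p, L p ∈ leadingCone n r → (L p).PosSemidef := by
    intro p hp
    refine posSemidef_of_mem_leadingCone ?_ ?_ hp
    · rw [hL, Matrix.IsSymm, Matrix.transpose_sub, Matrix.transpose_smul, Matrix.transpose_sum,
        isSymm_Zmat]
      simp only [Matrix.transpose_smul, (hA _).eq]
    · intro a b hab
      rw [hL, Matrix.sub_apply, Matrix.smul_apply, Zmat_apply_eq_zero hab,
        Matrix.sum_apply, smul_zero, zero_sub, neg_eq_zero]
      refine Finset.sum_eq_zero fun i _ => ?_
      rw [Matrix.smul_apply, hT]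
      split_ifs with hi
      · rw [hk i hi a b hab, smul_zero]
      · rw [zero_smul]
  have nonneg : ∀ p, L p ∈ leadingCone n r → 0 ≤ f p := by
    intro p hp
    have hM := hpsd p hp
    rw [hf]
    rw [hL] at hM
    set x := T p.2
    set t := p.1
    rcases lt_or_ge 0 t with ht | ht
    · have h := hub (t⁻¹ • x) (by
        have h := hM.smul (inv_nonneg.mpr ht.le)
        rw [smul_sub, smul_smul, inv_mul_cancel₀ ht.ne', one_smul, Finset.smul_sum] at h
        simpa [IsFeasible, smul_smul] using h)
      have e : ∑ i, c i * (t⁻¹ • x) i = t⁻¹ * ∑ i, c i * x i := by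
        rw [Finset.mul_sum]
        refine Finset.sum_congr rfl fun i _ => ?_
        rw [Pi.smul_apply, smul_eq_mul]
        ring
      rw [e, inv_mul_le_iff₀ ht] at h
      linarith
    · have hfeas : ∀ z, IsFeasible A (Zmat n r) z → ∀ s : ℝ, 0 ≤ s →
          (1 - s * t) * ∑ i, c i * z i + s * ∑ i, c i * x i ≤ v := by
        intro z hz s hs
        have h1 : 0 ≤ 1 - s * t := by nlinarith
        have h := hub ((1 - s * t) • z + s • x) (by
          have h := (hz.smul h1).add (hM.smul hs)
          unfold IsFeasible
          convert h using 1
          simp only [Pi.add_apply, Pi.smul_apply, smul_eq_mul, add_smul, mul_smul,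
            Finset.sum_add_distrib, ← Finset.smul_sum]
          module)
        convert h using 1
        rw [Finset.mul_sum, Finset.mul_sum, ← Finset.sum_add_distrib]
        refine Finset.sum_congr rfl fun i _ => ?_
        simp only [Pi.add_apply, Pi.smul_apply, smul_eq_mul]
        ring
      have hle : ∀ z, IsFeasible A (Zmat n r) z →
          -t * ∑ i, c i * z i + ∑ i, c i * x i ≤ 0 := by
        intro z hz
        by_contra! hδ
        set δ := -t * ∑ i, c i * z i + ∑ i, c i * x i with hδ'
        have hvz : 0 ≤ v - ∑ i, c i * z i := sub_nonneg.mpr (hub z hz)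
        have h := hfeas z hz ((v - ∑ i, c i * z i + 1) / δ) (by positivity)
        have e : (v - ∑ i, c i * z i + 1) / δ * δ = v - ∑ i, c i * z i + 1 :=
          div_mul_cancel₀ _ hδ.ne'
        have e' : (1 - (v - ∑ i, c i * z i + 1) / δ * t) * ∑ i, c i * z i +
            (v - ∑ i, c i * z i + 1) / δ * ∑ i, c i * x i =
            ∑ i, c i * z i + (v - ∑ i, c i * z i + 1) / δ * δ := by
          rw [hδ']
          ring
        linarith
      rcases ht.lt_or_eq with ht | ht
      · have h : v ≤ (∑ i, c i * x i) / t := by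
          refine hv.2 ?_
          rintro _ ⟨z, hz, rfl⟩
          rw [le_div_iff_of_neg ht]
          linarith [hle z hz]
        rw [le_div_iff_of_neg ht] at h
        linarith
      · have h := hle 0 (by simpa [IsFeasible] using posSemidef_Zmat n r)
        rw [ht] at h ⊢
        linarith
  obtain ⟨g, hg, hgs⟩ := riesz_extension_of_parametrization (leadingCone n r) L f nonneg
    (fun M => by
      obtain ⟨t, ht⟩ := exists_smul_Zmat_add_mem_leadingCone (r := r) M
      refine ⟨(t, 0), ?_⟩
      rw [hL]
      simpa using ht)
  refine ⟨g, fun i hi => ?_, ?_, hgs⟩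
  · have hTi : T (Pi.single i 1) = Pi.single i 1 := by
      funext j
      rw [hT]
      rcases eq_or_ne j i with rfl | hji
      · simp [hi]
      · simp [hji]
    have h := hg (0, Pi.single i 1)
    rw [hL, hf, hTi] at h
    simpa [Pi.single_apply] using h
  · have h := hg (1, 0)
    rw [hL, hf] at h
    simpa using h

theorem block22_eq_zero {n r : ℕ} (hr : r ≤ n) {M : Matrix (Fin n) (Fin n) ℝ}
    (h0 : ∀ a b : Fin n, (r ≤ (a : ℕ) ∨ r ≤ (b : ℕ)) → M a b = 0) : block22 r hr M = 0 := by
  ext i j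
  exact h0 _ _ (Or.inl (Nat.le_add_right _ _))

/-- `block22` as a linear map. -/
def block22Linear (n r : ℕ) (hr : r ≤ n) :
    Matrix (Fin n) (Fin n) ℝ →ₗ[ℝ] Matrix (Fin (n - r)) (Fin (n - r)) ℝ where
  toFun := block22 r hr
  map_add' _ _ := rfl
  map_smul' _ _ := rfl

/-- If the system is in good normal form, then it is well behaved:
every finite primal optimal value is attained by a dual feasible `Y`. -/
theorem stmt7 {n m : ℕ} (hn : 0 < n) (hm : 0 < m)
    (A : Fin m → Matrix (Fin n) (Fin n) ℝ) (B : Matrix (Fin n) (Fin n) ℝ)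
    (hA : ∀ i, (A i).IsSymm)
    (r : ℕ) (hr : r ≤ n) (hgnf : GoodNormalForm A B r hr)
    (c : Fin m → ℝ) (v : ℝ) (hv : IsLUB (PrimalVals A B c) v) :
    ∃ Y : Matrix (Fin n) (Fin n) ℝ,
      Y.PosSemidef ∧ (∀ i, ip (A i) Y = c i) ∧ ip B Y = v := by
  obtain ⟨rfl, -, k, hk, hzero, hli, U, hU, hUA⟩ := hgnf
  obtain ⟨g, hgA, hgZ, hgs⟩ := exists_nonneg_functional_of_isLUB hA hzero hv
  obtain ⟨ψ, hψ⟩ := hli.exists_linearMap_apply_eq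
    fun i => c ⟨k + i.1, by omega⟩ - g (A ⟨k + i.1, by omega⟩)
  obtain ⟨t, ht⟩ := hU.exists_nonneg_add_mul (fun y => ψ (vecMulVec y y))
    (ψ.continuous_of_finiteDimensional.comp (by fun_prop)) (by
      intro a y
      rw [smul_vecMulVec, vecMulVec_smul, map_smul, map_smul, smul_eq_mul, smul_eq_mul]
      ring)
  let u : Matrix (Fin (n - r)) (Fin (n - r)) ℝ →ₗ[ℝ] ℝ :=
    Matrix.traceLinearMap _ ℝ ℝ ∘ₗ LinearMap.mulRight ℝ U
  have hu : ∀ M, u M = ip M U := fun M => rfl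
  obtain ⟨Y, hY, hYφ⟩ := exists_posSemidef_ip_eq (g + (ψ + t • u) ∘ₗ block22Linear n r hr) (by
    intro y
    have hblock : block22 r hr (vecMulVec y y) =
        vecMulVec (fun i : Fin (n - r) => y ⟨r + i.1, by omega⟩)
          (fun i : Fin (n - r) => y ⟨r + i.1, by omega⟩) := rfl
    have h₁ : 0 ≤ g (vecMulVec y y) := hgs _ fun z _ => by
      rw [vecMulVec_mulVec, dotProduct_smul, dotProduct_comm y z]
      exact mul_self_nonneg (z ⬝ᵥ y)
    have h₂ := ht fun i : Fin (n - r) => y ⟨r + i.1, by omega⟩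
    rw [← ip_vecMulVec_self] at h₂
    exact add_nonneg h₁ h₂)
  have hYφ' : ∀ M, M.IsSymm →
      ip M Y = g M + (ψ (block22 r hr M) + t * ip (block22 r hr M) U) := hYφ
  refine ⟨Y, hY, fun i => ?_, ?_⟩
  · rw [hYφ' _ (hA i)]
    rcases lt_or_ge (i : ℕ) k with hi | hi
    · rw [block22_eq_zero hr (hzero i hi), hgA i hi]
      simp [ip]
    · have h := hψ ⟨i - k, by omega⟩
      have e : (⟨k + (i - k), by omega⟩ : Fin m) = i := Fin.ext (by simp; omega)
      simp only [e] at h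
      rw [hUA i hi, h]
      ring
  · rw [hYφ' _ (isSymm_Zmat n r), block22_eq_zero hr fun _ _ => Zmat_apply_eq_zero, hgZ]
    simp [ip]
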